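/- arXiv:1404.4868 — 9 statements merged into one kernel-verified Lean document; each statement's English description precedes it below -/
import Mathlib

section
/- Let (u₀♮, u₁♮) ∈ P₀ × P₁ satisfy J₁(u₀♮, u₁♮) ≥ V⁻ (i.e. (u₀♮, u₁♮) ∈ A). Then there exists an incentive strategy of the leader α : P₁ → P₀ such that α(u₁♮) = u₀♮ and u₁♮ is an optimal strategy of the follower against α (u₁♮ ∈ F(α)). -/
/-- For any pair `(u₀♮, u₁♮) ∈ A` (i.e. `J₁ u₀♮ u₁♮ ≥ V⁻`) there is
an incentive strategy `α` of the leader with `α u₁♮ = u₀♮` and `u₁♮ ∈ F(α)`. -/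
theorem exists_incentive_strategy_of_mem_A
    {P₀ P₁ : Type*} [TopologicalSpace P₀] [TopologicalSpace P₁]
    [CompactSpace P₀] [CompactSpace P₁] [Nonempty P₀] [Nonempty P₁]
    (J₀ J₁ : P₀ → P₁ → ℝ)
    (hJ₀ : Continuous fun p : P₀ × P₁ => J₀ p.1 p.2)
    (hJ₁ : Continuous fun p : P₀ × P₁ => J₁ p.1 p.2)
    (u₀ : P₀) (u₁ : P₁)
    (hA : J₁ u₀ u₁ ≥ ⨆ v : P₁, ⨅ w : P₀, J₁ w v) :
    ∃ α : P₁ → P₀, α u₁ = u₀ ∧ ∀ v : P₁, J₁ (α v) v ≤ J₁ (α u₁) u₁ := by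
  classical
  have hmin : ∀ v : P₁, ∃ w : P₀, ∀ w' : P₀, J₁ w v ≤ J₁ w' v := fun v => by
    have hv : Continuous fun w : P₀ => J₁ w v := hJ₁.comp (Continuous.prodMk_left v)
    obtain ⟨w, -, hw⟩ := isCompact_univ.exists_isMinOn Set.univ_nonempty hv.continuousOn
    exact ⟨w, fun w' => hw (Set.mem_univ w')⟩
  choose m hm using hmin
  have hinf : ∀ v : P₁, ⨅ w : P₀, J₁ w v = J₁ (m v) v := fun v =>
    le_antisymm (ciInf_le ⟨J₁ (m v) v, Set.forall_mem_range.2 (hm v)⟩ (m v)) (le_ciInf (hm v))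
  have hbdd : BddAbove (Set.range fun v : P₁ => ⨅ w : P₀, J₁ w v) := by
    obtain ⟨C, hC⟩ := (isCompact_range hJ₁).bddAbove
    refine ⟨C, Set.forall_mem_range.2 fun v => ?_⟩
    rw [hinf v]
    exact hC ⟨(m v, v), rfl⟩
  refine ⟨Function.update m u₁ u₀, Function.update_self .., fun v => ?_⟩
  rw [Function.update_self]
  obtain rfl | hv := eq_or_ne v u₁
  · rw [Function.update_self]
  · rw [Function.update_of_ne hv, ← hinf v]
    exact (le_ciSup hbdd v).trans hA
end

section
/- If (α*, u₁*) is an inverse Stackelberg solution, then the pair (u₀*, u₁*) with u₀* = α*(u₁*) belongs to the set A and maximizes J₀ over A, i.e. J₀(u₀*, u₁*) ≥ J₀(u₀, u₁) for every (u₀, u₁) ∈ A. -/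
/-- If `(α*, u₁*)` is an inverse Stackelberg solution, then
`(α* u₁*, u₁*)` belongs to `A` and maximizes `J₀` over `A`. -/
theorem inverse_stackelberg_maximizes_over_A
    {P₀ P₁ : Type*} [TopologicalSpace P₀] [TopologicalSpace P₁]
    [CompactSpace P₀] [CompactSpace P₁] [Nonempty P₀] [Nonempty P₁]
    (J₀ J₁ : P₀ → P₁ → ℝ)
    (hJ₀ : Continuous fun p : P₀ × P₁ => J₀ p.1 p.2)
    (hJ₁ : Continuous fun p : P₀ × P₁ => J₁ p.1 p.2)
    (αs : P₁ → P₀) (u₁s : P₁)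
    -- `u₁* ∈ F(α*)`:
    (hF : ∀ v : P₁, J₁ (αs v) v ≤ J₁ (αs u₁s) u₁s)
    -- team-optimality of `(α*, u₁*)`:
    (hopt : ∀ (α : P₁ → P₀) (u₁ : P₁),
      (∀ v : P₁, J₁ (α v) v ≤ J₁ (α u₁) u₁) → J₀ (α u₁) u₁ ≤ J₀ (αs u₁s) u₁s) :
    J₁ (αs u₁s) u₁s ≥ (⨆ v : P₁, ⨅ w : P₀, J₁ w v) ∧
      ∀ u₀ : P₀, ∀ u₁ : P₁,
        J₁ u₀ u₁ ≥ (⨆ v : P₁, ⨅ w : P₀, J₁ w v) → J₀ u₀ u₁ ≤ J₀ (αs u₁s) u₁s := by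
  classical
  have hcont : ∀ v, Continuous fun w => J₁ w v := fun v =>
    hJ₁.comp (continuous_id.prodMk continuous_const)
  have hbelow : ∀ v, BddBelow (Set.range fun w => J₁ w v) := fun v =>
    (isCompact_range (hcont v)).bddBelow
  have habove : BddAbove (Set.range fun v => ⨅ w, J₁ w v) := by
    obtain ⟨C, hC⟩ := (isCompact_range hJ₁).bddAbove
    refine ⟨C, ?_⟩
    rintro _ ⟨v, rfl⟩
    exact (ciInf_le (hbelow v) (Classical.arbitrary P₀)).trans
      (hC ⟨(Classical.arbitrary P₀, v), rfl⟩)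
  refine ⟨ciSup_le fun v => (ciInf_le (hbelow v) (αs v)).trans (hF v), fun u₀ u₁ hA => ?_⟩
  have hmin : ∀ v, ∃ w, ∀ w', J₁ w v ≤ J₁ w' v := fun v => by
    obtain ⟨w, -, hw⟩ := isCompact_univ.exists_isMinOn Set.univ_nonempty (hcont v).continuousOn
    exact ⟨w, fun w' => hw (Set.mem_univ w')⟩
  choose threat hthreat using hmin
  have key := hopt (Function.update threat u₁ u₀) u₁ fun v => by
    rw [Function.update_self]
    by_cases hv : v = u₁
    · subst hv
      rw [Function.update_self]
    · rw [Function.update_of_ne hv]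
      exact (le_ciInf (hthreat v)).trans ((le_ciSup habove v).trans hA)
  rwa [Function.update_self] at key
end

section
/- If a pair (u₀*, u₁*) ∈ A maximizes J₀ over the set A (i.e. J₀(u₀*, u₁*) ≥ J₀(u₀, u₁) for every (u₀, u₁) ∈ A), then there exists an incentive strategy of the leader α* : P₁ → P₀ such that α*(u₁*) = u₀* and (α*, u₁*) is an inverse Stackelberg solution. -/
/-- If `(u₀*, u₁*) ∈ A` maximizes `J₀` over `A`, then there is an
incentive strategy `α*` with `α* u₁* = u₀*` such that `(α*, u₁*)` is an inverse
Stackelberg solution. -/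
theorem exists_inverse_stackelberg_of_maximizer
    {P₀ P₁ : Type*} [TopologicalSpace P₀] [TopologicalSpace P₁]
    [CompactSpace P₀] [CompactSpace P₁] [Nonempty P₀] [Nonempty P₁]
    (J₀ J₁ : P₀ → P₁ → ℝ)
    (hJ₀ : Continuous fun p : P₀ × P₁ => J₀ p.1 p.2)
    (hJ₁ : Continuous fun p : P₀ × P₁ => J₁ p.1 p.2)
    (u₀s : P₀) (u₁s : P₁)
    (hmem : J₁ u₀s u₁s ≥ ⨆ v : P₁, ⨅ w : P₀, J₁ w v)
    (hmax : ∀ u₀ : P₀, ∀ u₁ : P₁,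
      J₁ u₀ u₁ ≥ (⨆ v : P₁, ⨅ w : P₀, J₁ w v) → J₀ u₀ u₁ ≤ J₀ u₀s u₁s) :
    ∃ αs : P₁ → P₀, αs u₁s = u₀s ∧
      -- `u₁* ∈ F(α*)`:
      (∀ v : P₁, J₁ (αs v) v ≤ J₁ (αs u₁s) u₁s) ∧
      -- team optimality:
      ∀ (α : P₁ → P₀) (u₁ : P₁),
        (∀ v : P₁, J₁ (α v) v ≤ J₁ (α u₁) u₁) → J₀ (α u₁) u₁ ≤ J₀ (αs u₁s) u₁s := by
  classical
  have hcont (v : P₁) : Continuous fun w => J₁ w v :=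
    hJ₁.comp (continuous_id.prodMk continuous_const)
  have hbdd (v : P₁) : BddBelow (Set.range fun w => J₁ w v) :=
    (isCompact_range (hcont v)).bddBelow
  have hargmin (v : P₁) : ∃ w, J₁ w v = ⨅ w, J₁ w v :=
    (isCompact_range (hcont v)).sInf_mem (Set.range_nonempty _)
  choose m hm using hargmin
  have hbddAbove : BddAbove (Set.range fun v : P₁ => ⨅ w : P₀, J₁ w v) := by
    obtain ⟨C, hC⟩ := (isCompact_range hJ₁).bddAbove
    refine ⟨C, ?_⟩
    rintro _ ⟨v, rfl⟩
    exact (hm v).symm.trans_le (hC ⟨(m v, v), rfl⟩)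
  refine ⟨Function.update m u₁s u₀s, by simp, fun v => ?_, fun α u₁ h => ?_⟩
  · rcases eq_or_ne v u₁s with rfl | hv
    · exact le_rfl
    · rw [Function.update_of_ne hv, Function.update_self, hm v]
      exact (le_ciSup hbddAbove v).trans hmem
  · rw [Function.update_self]
    exact hmax _ _ (ciSup_le fun v => (ciInf_le (hbdd v) (α v)).trans (h v))
end

section
/- There exists at least one inverse Stackelberg solution (α*, u₁*) of the two-player static game. -/
/-- There exists at least one inverse Stackelberg solution of the
two-player static game. -/
theorem exists_inverse_stackelberg
    {P₀ P₁ : Type*} [TopologicalSpace P₀] [TopologicalSpace P₁]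
    [CompactSpace P₀] [CompactSpace P₁] [Nonempty P₀] [Nonempty P₁]
    (J₀ J₁ : P₀ → P₁ → ℝ)
    (hJ₀ : Continuous fun p : P₀ × P₁ => J₀ p.1 p.2)
    (hJ₁ : Continuous fun p : P₀ × P₁ => J₁ p.1 p.2) :
    ∃ (αs : P₁ → P₀) (u₁s : P₁),
      -- `u₁* ∈ F(α*)`:
      (∀ v : P₁, J₁ (αs v) v ≤ J₁ (αs u₁s) u₁s) ∧
      -- team optimality:
      ∀ (α : P₁ → P₀) (u₁ : P₁),
        (∀ v : P₁, J₁ (α v) v ≤ J₁ (α u₁) u₁) → J₀ (α u₁) u₁ ≤ J₀ (αs u₁s) u₁s := by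
  classical
  have hmin : ∀ v : P₁, ∃ a : P₀, ∀ x : P₀, J₁ a v ≤ J₁ x v := fun v => by
    have hc : Continuous fun x : P₀ => J₁ x v :=
      hJ₁.comp (continuous_id.prodMk continuous_const)
    obtain ⟨a, -, ha⟩ := isCompact_univ.exists_isMinOn Set.univ_nonempty hc.continuousOn
    exact ⟨a, fun x => ha (Set.mem_univ x)⟩
  choose p hp using hmin
  have husc : UpperSemicontinuous fun v => J₁ (p v) v := fun v c hc => by
    have hcont : Continuous fun w : P₁ => J₁ (p v) w :=
      hJ₁.comp (continuous_const.prodMk continuous_id)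
    filter_upwards [hcont.continuousAt.eventually_lt_const hc] with w hw
    exact (hp w (p v)).trans_lt hw
  obtain ⟨w, -, hw⟩ := UpperSemicontinuousOn.exists_isMaxOn Set.univ_nonempty
    isCompact_univ (husc.upperSemicontinuousOn Set.univ)
  have hclosed : IsClosed {q : P₀ × P₁ | ∀ v, J₁ (p v) v ≤ J₁ q.1 q.2} := by
    simp only [Set.ofPred_forall]
    exact isClosed_iInter fun v => isClosed_le continuous_const hJ₁
  obtain ⟨⟨a, b⟩, hab, hmax⟩ := hclosed.isCompact.exists_isMaxOn
    ⟨(p w, w), fun v => hw (Set.mem_univ v)⟩ hJ₀.continuousOn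
  refine ⟨Function.update p b a, b, fun v => ?_, fun α u hu => ?_⟩
  · rw [Function.update_self]
    by_cases hv : v = b
    · subst hv
      rw [Function.update_self]
    · rw [Function.update_of_ne hv]
      exact hab v
  · rw [Function.update_self]
    have hmem : (α u, u) ∈ {q : P₀ × P₁ | ∀ v, J₁ (p v) v ≤ J₁ q.1 q.2} :=
      fun v => (hp v (α v)).trans (hu v)
    exact hmax hmem
end

section
/- Let α : P → P₀ be an incentive strategy of the leader and let u♮ ∈ E(α) be a followers' Nash equilibrium against α. Then the pair (α(u♮), u♮) belongs to the set B, i.e. for every i = 1, …, n, J_i(α(u♮), u♮) ≥ max_{u_i ∈ P_i} min_{u₀ ∈ P₀} J_i(u₀, (u_i, u♮_{−i})). -/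
/-- If the profile `u` is a followers' Nash equilibrium against
the incentive strategy `α`, then `(α u, u)` belongs to the set `B`: for each
follower `i`, `J_i (α u) u ≥ max_{v ∈ P_i} min_{w ∈ P₀} J_i w (v, u_{-i})`. -/
theorem nash_equilibrium_mem_B
    {n : ℕ} {P₀ : Type*} {P : Fin n → Type*}
    [TopologicalSpace P₀] [CompactSpace P₀] [Nonempty P₀]
    [∀ i, TopologicalSpace (P i)] [∀ i, CompactSpace (P i)] [∀ i, Nonempty (P i)]
    (J₀ : P₀ → (∀ i, P i) → ℝ) (J : Fin n → P₀ → (∀ i, P i) → ℝ)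
    (hJ₀ : Continuous fun p : P₀ × (∀ i, P i) => J₀ p.1 p.2)
    (hJ : ∀ i, Continuous fun p : P₀ × (∀ i, P i) => J i p.1 p.2)
    (α : (∀ i, P i) → P₀) (u : ∀ i, P i)
    -- `u ∈ E(α)`:
    (hNash : ∀ i, ∀ v : P i,
      J i (α (Function.update u i v)) (Function.update u i v) ≤ J i (α u) u) :
    ∀ i, J i (α u) u ≥ ⨆ v : P i, ⨅ w : P₀, J i w (Function.update u i v) := by
  intro i
  refine ciSup_le fun v => (ciInf_le ?_ (α (Function.update u i v))).trans (hNash i v)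
  exact (isCompact_range ((hJ i).comp (continuous_id.prodMk continuous_const))).bddBelow
end

section
/- Let u₀♮ ∈ P₀ and u♮ ∈ P be such that (u₀♮, u♮) ∈ B. Then there exists an incentive strategy of the leader α : P → P₀ such that α(u♮) = u₀♮ and u♮ ∈ E(α). -/
/-- If the max-min value of a continuous function on a product of compact spaces is at most `c`,
then every `y` has a response `x` with `f x y ≤ c`. -/
theorem exists_le_of_iSup_iInf_le {X Y : Type*} [TopologicalSpace X] [CompactSpace X] [Nonempty X]
    [TopologicalSpace Y] [CompactSpace Y] {f : X → Y → ℝ}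
    (hf : Continuous fun p : X × Y => f p.1 p.2) {c : ℝ} (hc : ⨆ y, ⨅ x, f x y ≤ c) (y : Y) :
    ∃ x, f x y ≤ c := by
  obtain ⟨M, hM⟩ := (isCompact_range hf).bddAbove
  have bddBelow (y : Y) : BddBelow (Set.range fun x => f x y) :=
    (isCompact_range (hf.comp (Continuous.prodMk_left y))).bddBelow
  have bddAbove : BddAbove (Set.range fun y => ⨅ x, f x y) := by
    refine ⟨M, ?_⟩
    rintro _ ⟨y, rfl⟩
    exact (ciInf_le (bddBelow y) (Classical.arbitrary X)).trans (hM ⟨(_, y), rfl⟩)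
  have hy : Continuous fun x => f x y := hf.comp (Continuous.prodMk_left y)
  obtain ⟨x, -, hx⟩ := isCompact_univ.exists_isMinOn Set.univ_nonempty hy.continuousOn
  exact ⟨x, (le_ciInf fun z => hx (Set.mem_univ z)).trans ((le_ciSup bddAbove y).trans hc)⟩


/-- If `(u₀♮, u♮) ∈ B`, then there exists an incentive strategy
`α` with `α u♮ = u₀♮` such that `u♮` is a followers' Nash equilibrium
against `α`. -/
theorem exists_incentive_strategy_of_mem_B
    {n : ℕ} {P₀ : Type*} {P : Fin n → Type*}
    [TopologicalSpace P₀] [CompactSpace P₀] [Nonempty P₀]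
    [∀ i, TopologicalSpace (P i)] [∀ i, CompactSpace (P i)] [∀ i, Nonempty (P i)]
    (J₀ : P₀ → (∀ i, P i) → ℝ) (J : Fin n → P₀ → (∀ i, P i) → ℝ)
    (hJ₀ : Continuous fun p : P₀ × (∀ i, P i) => J₀ p.1 p.2)
    (hJ : ∀ i, Continuous fun p : P₀ × (∀ i, P i) => J i p.1 p.2)
    (u₀ : P₀) (u : ∀ i, P i)
    -- `(u₀, u) ∈ B`:
    (hB : ∀ i, J i u₀ u ≥ ⨆ v : P i, ⨅ w : P₀, J i w (Function.update u i v)) :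
    ∃ α : (∀ i, P i) → P₀, α u = u₀ ∧
      ∀ i, ∀ v : P i,
        J i (α (Function.update u i v)) (Function.update u i v) ≤ J i (α u) u := by
  have exists_response (x : ∀ i, P i) : ∃ w : P₀, (x = u → w = u₀) ∧
      ∀ i, ∀ v : P i, x = Function.update u i v → J i w x ≤ J i u₀ u := by
    by_cases hx : x = u
    · subst hx
      exact ⟨u₀, fun _ => rfl, fun i v _ => le_rfl⟩
    by_cases hdev : ∃ i, ∃ v : P i, x = Function.update u i v
    · obtain ⟨i, v, hxv⟩ := hdev
      have hcont : Continuous fun p : P₀ × P i => J i p.1 (Function.update u i p.2) :=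
        (hJ i).comp (continuous_fst.prodMk (continuous_const.update i continuous_snd))
      obtain ⟨w, hw⟩ := exists_le_of_iSup_iInf_le hcont (hB i) v
      refine ⟨w, fun h => absurd h hx, fun j v' hxv' => ?_⟩
      obtain rfl : j = i := by
        by_contra hji
        refine hx ?_
        have hvi : v = u i := by
          have := congrFun (hxv.symm.trans hxv') i
          rwa [Function.update_self, Function.update_of_ne (Ne.symm hji)] at this
        rw [hxv, hvi, Function.update_eq_self]
      rwa [hxv]
    · exact ⟨u₀, fun _ => rfl, fun i v h => absurd ⟨i, v, h⟩ hdev⟩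
  choose α hα hle using exists_response
  refine ⟨α, hα u rfl, fun i v => ?_⟩
  rw [hα u rfl]
  exact hle _ i v rfl
end

section
/- If (α*, u*) is an inverse Stackelberg solution of the game with one leader and n followers playing Nash equilibrium, then the pair (u₀*, u*) with u₀* = α*(u*) belongs to the set B and maximizes J₀ over B, i.e. J₀(u₀*, u*) ≥ J₀(u₀, u) for every (u₀, u) ∈ B. -/
/-- An incentive strategy that plays `u₀` at `u` and punishes every unilateral deviation of
player `i` from `u` with the leader's decision `m i x` against the resulting profile `x`. -/
theorem exists_punishing_strategy {ι P₀ : Type*} [DecidableEq ι] {P : ι → Type*}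
    (m : ι → (∀ i, P i) → P₀) (u₀ : P₀) (u : ∀ i, P i) :
    ∃ α : (∀ i, P i) → P₀, α u = u₀ ∧
      ∀ i, ∀ v : P i, v ≠ u i → α (Function.update u i v) = m i (Function.update u i v) := by
  classical
  refine ⟨fun x => if h : ∃ i, x i ≠ u i then m h.choose x else u₀, by simp, fun i v hv => ?_⟩
  have h : ∃ j, Function.update u i v j ≠ u j := ⟨i, by simpa using hv⟩
  have hi : h.choose = i := by
    by_contra hne
    exact h.choose_spec (Function.update_of_ne hne _ _)
  simp only [dif_pos h, hi]

/-- If `(α*, u*)` is an inverse Stackelberg solution of the game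
with one leader and `n` followers playing Nash equilibrium, then
`(α* u*, u*) ∈ B` and it maximizes `J₀` over `B`. -/
theorem inverse_stackelberg_many_followers_maximizes_over_B
    {n : ℕ} {P₀ : Type*} {P : Fin n → Type*}
    [TopologicalSpace P₀] [CompactSpace P₀] [Nonempty P₀]
    [∀ i, TopologicalSpace (P i)] [∀ i, CompactSpace (P i)] [∀ i, Nonempty (P i)]
    (J₀ : P₀ → (∀ i, P i) → ℝ) (J : Fin n → P₀ → (∀ i, P i) → ℝ)
    (hJ₀ : Continuous fun p : P₀ × (∀ i, P i) => J₀ p.1 p.2)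
    (hJ : ∀ i, Continuous fun p : P₀ × (∀ i, P i) => J i p.1 p.2)
    (αs : (∀ i, P i) → P₀) (us : ∀ i, P i)
    -- `u* ∈ E(α*)`:
    (hNash : ∀ i, ∀ v : P i,
      J i (αs (Function.update us i v)) (Function.update us i v) ≤ J i (αs us) us)
    -- optimality of `(α*, u*)`:
    (hopt : ∀ (α : (∀ i, P i) → P₀) (u : ∀ i, P i),
      (∀ i, ∀ v : P i,
        J i (α (Function.update u i v)) (Function.update u i v) ≤ J i (α u) u) →
      J₀ (α u) u ≤ J₀ (αs us) us) :
    -- `(α* u*, u*) ∈ B`: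
    (∀ i, J i (αs us) us ≥ ⨆ v : P i, ⨅ w : P₀, J i w (Function.update us i v)) ∧
    -- `(α* u*, u*)` maximizes `J₀` over `B`:
    ∀ (u₀ : P₀) (u : ∀ i, P i),
      (∀ i, J i u₀ u ≥ ⨆ v : P i, ⨅ w : P₀, J i w (Function.update u i v)) →
      J₀ u₀ u ≤ J₀ (αs us) us := by
  have hbdd : ∀ i x, BddBelow (Set.range fun w => J i w x) := fun i x =>
    (isCompact_range ((hJ i).comp (Continuous.prodMk_left x))).bddBelow
  refine ⟨fun i => ciSup_le fun v => (ciInf_le (hbdd i _) _).trans (hNash i v), ?_⟩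
  intro u₀ u hB
  have hmin : ∀ i x, ∃ w, J i w x = ⨅ w, J i w x := fun i x =>
    (isCompact_range ((hJ i).comp (Continuous.prodMk_left x))).sInf_mem (Set.range_nonempty _)
  choose m hm using hmin
  obtain ⟨α, hαu, hα⟩ := exists_punishing_strategy m u₀ u
  rw [← hαu]
  refine hopt α u fun i v => ?_
  by_cases hv : v = u i
  · simp [hv]
  rw [hα i v hv, hm, hαu]
  obtain ⟨M, hM⟩ := (isCompact_range (hJ i)).bddAbove
  have hsup : BddAbove (Set.range fun v : P i => ⨅ w, J i w (Function.update u i v)) := by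
    refine ⟨M, ?_⟩
    rintro _ ⟨v, rfl⟩
    exact (ciInf_le (hbdd i _) u₀).trans (hM ⟨(u₀, Function.update u i v), rfl⟩)
  exact (le_ciSup hsup v).trans (hB i)
end

section
/- If a pair (u₀*, u*) ∈ B maximizes J₀ over the set B (i.e. J₀(u₀*, u*) ≥ J₀(u₀, u) for every (u₀, u) ∈ B), then there exists an incentive strategy of the leader α* : P → P₀ such that α*(u*) = u₀* and (α*, u*) is an inverse Stackelberg solution of the game with one leader and n followers playing Nash equilibrium. -/
/-- A real-valued continuous function on a product of compact spaces is bounded below in its first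
variable. -/
theorem bddBelow_range_of_continuous_uncurried {X Y : Type*} [TopologicalSpace X] [CompactSpace X]
    [TopologicalSpace Y] {f : X → Y → ℝ} (hf : Continuous fun p : X × Y => f p.1 p.2) (y : Y) :
    BddBelow (Set.range fun x => f x y) :=
  (isCompact_range (hf.comp (Continuous.prodMk_left y))).bddBelow

/-- The partial infimum of a continuous function on a product of compact spaces is attained. -/
theorem exists_eq_iInf_of_continuous_uncurried {X Y : Type*} [TopologicalSpace X] [CompactSpace X]
    [Nonempty X] [TopologicalSpace Y] {f : X → Y → ℝ}
    (hf : Continuous fun p : X × Y => f p.1 p.2) (y : Y) :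
    ∃ x, f x y = ⨅ x', f x' y :=
  (isCompact_range (hf.comp (Continuous.prodMk_left y))).sInf_mem (Set.range_nonempty _)

/-- The partial infimum of a continuous function on a product of compact spaces is bounded above. -/
theorem bddAbove_range_iInf_of_continuous_uncurried {X Y : Type*} [TopologicalSpace X]
    [CompactSpace X] [Nonempty X] [TopologicalSpace Y] [CompactSpace Y] {f : X → Y → ℝ}
    (hf : Continuous fun p : X × Y => f p.1 p.2) :
    BddAbove (Set.range fun y => ⨅ x, f x y) := by
  obtain ⟨M, hM⟩ := (isCompact_range hf).bddAbove
  refine ⟨M, ?_⟩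
  rintro _ ⟨y, rfl⟩
  obtain ⟨x, hx⟩ := exists_eq_iInf_of_continuous_uncurried hf y
  exact hx.symm.trans_le (hM ⟨(x, y), rfl⟩)

/-- Two unilateral deviations from `u` that agree and differ from `u` are made in the same
coordinate. -/
theorem Function.eq_of_update_eq_update_of_ne {ι : Type*} [DecidableEq ι] {P : ι → Type*}
    {u : ∀ i, P i} {i j : ι} {v : P i} {w : P j}
    (h : Function.update u i v = Function.update u j w) (hne : Function.update u i v ≠ u) :
    i = j := by
  by_contra hij
  have hv : v = u i := by
    simpa [Function.update_of_ne hij] using congrFun h i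
  exact hne (by rw [hv, Function.update_eq_self])


/-- If `(u₀*, u*) ∈ B` maximizes `J₀` over `B`, then there exists
an incentive strategy `α*` with `α* u* = u₀*` such that `(α*, u*)` is an inverse
Stackelberg solution of the game with one leader and `n` followers playing
Nash equilibrium. -/
theorem exists_inverse_stackelberg_many_followers_of_maximizer
    {n : ℕ} {P₀ : Type*} {P : Fin n → Type*}
    [TopologicalSpace P₀] [CompactSpace P₀] [Nonempty P₀]
    [∀ i, TopologicalSpace (P i)] [∀ i, CompactSpace (P i)] [∀ i, Nonempty (P i)]
    (J₀ : P₀ → (∀ i, P i) → ℝ) (J : Fin n → P₀ → (∀ i, P i) → ℝ)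
    (hJ₀ : Continuous fun p : P₀ × (∀ i, P i) => J₀ p.1 p.2)
    (hJ : ∀ i, Continuous fun p : P₀ × (∀ i, P i) => J i p.1 p.2)
    (u₀s : P₀) (us : ∀ i, P i)
    -- `(u₀*, u*) ∈ B`:
    (hmem : ∀ i, J i u₀s us ≥ ⨆ v : P i, ⨅ w : P₀, J i w (Function.update us i v))
    -- `(u₀*, u*)` maximizes `J₀` over `B`:
    (hmax : ∀ (u₀ : P₀) (u : ∀ i, P i),
      (∀ i, J i u₀ u ≥ ⨆ v : P i, ⨅ w : P₀, J i w (Function.update u i v)) →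
      J₀ u₀ u ≤ J₀ u₀s us) :
    ∃ αs : (∀ i, P i) → P₀, αs us = u₀s ∧
      -- `u* ∈ E(α*)`:
      (∀ i, ∀ v : P i,
        J i (αs (Function.update us i v)) (Function.update us i v) ≤ J i (αs us) us) ∧
      -- optimality of `(α*, u*)`:
      ∀ (α : (∀ i, P i) → P₀) (u : ∀ i, P i),
        (∀ i, ∀ v : P i,
          J i (α (Function.update u i v)) (Function.update u i v) ≤ J i (α u) u) →
        J₀ (α u) u ≤ J₀ (αs us) us := by
  have hpunish : ∀ u : ∀ i, P i, ∃ w : P₀, (u = us → w = u₀s) ∧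
      ∀ i, ∀ v : P i, u = Function.update us i v → J i w u ≤ J i u₀s us := by
    intro u
    by_cases hu : u = us
    · exact ⟨u₀s, fun _ => rfl, fun i v _ => by rw [hu]⟩
    by_cases hdev : ∃ i, ∃ v : P i, u = Function.update us i v
    · obtain ⟨i, v, rfl⟩ := hdev
      obtain ⟨w, hw⟩ := exists_eq_iInf_of_continuous_uncurried (hJ i) (Function.update us i v)
      refine ⟨w, fun h => absurd h hu, fun j v' hj => ?_⟩
      obtain rfl := Function.eq_of_update_eq_update_of_ne hj hu
      have hcont : Continuous fun p : P₀ × P i => J i p.1 (Function.update us i p.2) :=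
        (hJ i).comp (continuous_fst.prodMk (continuous_const.update i continuous_snd))
      rw [hw]
      exact (le_ciSup (bddAbove_range_iInf_of_continuous_uncurried hcont) v).trans (hmem i)
    · exact ⟨u₀s, fun h => absurd h hu, fun i v h => absurd ⟨i, v, h⟩ hdev⟩
  choose αs hαs hle using hpunish
  refine ⟨αs, hαs us rfl, fun i v => ?_, fun α u hα => ?_⟩
  · rw [hαs us rfl]
    exact hle _ i v rfl
  · rw [hαs us rfl]
    exact hmax _ _ fun i => ciSup_le fun v =>
      (ciInf_le (bddBelow_range_of_continuous_uncurried (hJ i) _) _).trans (hα i v)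
end

section
/- Suppose additionally that each P_i (i = 1, …, n) is a nonempty compact convex subset of a finite-dimensional real vector space and that for every u₀ ∈ P₀, every i = 1, …, n and every u_{−i}, the function u_i' ↦ J_i(u₀, (u_i', u_{−i})) is quasiconcave on P_i. Then there exists at least one inverse Stackelberg solution (α*, u*) of the game with one leader and n followers playing Nash equilibrium. -/
open Finset in
/-- The parity argument behind Sperner's lemma: a double count of the pairs of a door (a set with all
colours but `k`) and a room containing it. -/
theorem exists_image_eq_univ_of_odd_card_rooms {V I : Type*} [Fintype V] [DecidableEq V]
    [Fintype I] [DecidableEq I] (rooms : Finset (Finset V)) (c : V → I) (k : I) (D₀ : Finset V)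
    (hcard : ∀ R ∈ rooms, #R = Fintype.card I)
    (hD₀ : D₀.image c = univ.erase k) (hD₀' : #D₀ + 1 = Fintype.card I)
    (hodd : Odd #{R ∈ rooms | D₀ ⊆ R})
    (heven : ∀ D : Finset V, D.image c = univ.erase k → #D + 1 = Fintype.card I → D ≠ D₀ →
      Even #{R ∈ rooms | D ⊆ R}) :
    ∃ R ∈ rooms, R.image c = univ := by
  by_contra! hno
  set doors : Finset (Finset V) :=
    {D | D.image c = univ.erase k ∧ #D + 1 = Fintype.card I} with hdoors
  have hinj : ∀ D ∈ doors, Set.InjOn c D := by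
    intro D hD
    rw [hdoors, mem_filter] at hD
    apply card_image_iff.1
    rw [hD.2.1, card_erase_of_mem (mem_univ k), card_univ]
    omega
  have hcount := sum_card_bipartiteAbove_eq_sum_card_bipartiteBelow
    (s := doors) (t := rooms) (r := fun D R => D ⊆ R)
  simp only [bipartiteAbove, bipartiteBelow] at hcount
  have hright : Even (∑ R ∈ rooms, #{D ∈ doors | D ⊆ R}) := by
    refine even_sum _ fun R hR => ?_
    rcases eq_empty_or_nonempty {D ∈ doors | D ⊆ R} with he | ⟨D, hD⟩
    · simp [he]
    obtain ⟨hDd, hDR⟩ := mem_filter.1 hD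
    have hDc := (mem_filter.1 hDd).2
    have hsd : #(R \ D) = 1 := by
      have := card_sdiff_add_card_eq_card hDR
      have := hcard R hR
      omega
    obtain ⟨x, hx⟩ := card_eq_one.1 hsd
    have hxR : x ∈ R ∧ x ∉ D := mem_sdiff.1 (hx ▸ mem_singleton_self x)
    have hR_eq : R = insert x D := by
      rw [← sdiff_union_of_subset hDR, hx]; rfl
    have hcx : c x ∈ D.image c := by
      by_contra hcx
      have : c x = k := by simpa [hDc.1] using hcx
      apply hno R hR
      rw [hR_eq, image_insert, hDc.1, this, insert_erase (mem_univ k)]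
    obtain ⟨x', hx'D, hx'⟩ := mem_image.1 hcx
    have hxx' : x' ≠ x := fun h => hxR.2 (h ▸ hx'D)
    have hset : ({D ∈ doors | D ⊆ R} : Finset (Finset V)) = {D, R.erase x'} := by
      ext D'
      simp only [mem_filter, mem_insert, mem_singleton]
      constructor
      · rintro ⟨hD'd, hD'R⟩
        have hD'c := (mem_filter.1 hD'd).2
        have : x ∉ D' ∨ x' ∉ D' := by
          by_contra! h
          exact hxx' (hinj D' hD'd h.2 h.1 hx')
        have hR' := hcard R hR
        rcases this with h | h
        · left
          apply eq_of_subset_of_card_le _ (by omega)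
          intro z hz
          have := hD'R hz
          rw [hR_eq, mem_insert] at this
          rcases this with rfl | h'
          · exact absurd hz h
          · exact h'
        · right
          apply eq_of_subset_of_card_le
          · exact fun z hz => mem_erase.2 ⟨fun e => h (e ▸ hz), hD'R hz⟩
          · rw [card_erase_of_mem (hDR hx'D)]; omega
      · rintro (rfl | rfl)
        · exact ⟨hDd, hDR⟩
        · refine ⟨?_, erase_subset _ _⟩
          rw [hdoors, mem_filter]
          refine ⟨mem_univ _, ?_, ?_⟩
          · rw [← hDc.1]
            ext i
            simp only [mem_image, mem_erase, hR_eq, mem_insert]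
            constructor
            · rintro ⟨z, ⟨hz, rfl | hzD⟩, rfl⟩
              · exact ⟨x', hx'D, hx'⟩
              · exact ⟨z, hzD, rfl⟩
            · rintro ⟨z, hz, rfl⟩
              by_cases hzx : z = x'
              · exact ⟨x, ⟨hxx'.symm, Or.inl rfl⟩, by rw [hzx, hx']⟩
              · exact ⟨z, ⟨hzx, Or.inr hz⟩, rfl⟩
          · rw [card_erase_of_mem (hDR hx'D)]
            have := hcard R hR
            omega
    rw [hset, card_pair]
    · exact even_two
    · intro h
      rw [h] at hx'D
      exact notMem_erase _ _ hx'D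
  have hD₀d : D₀ ∈ doors := by simp [hdoors, hD₀, hD₀']
  rw [← hcount, ← add_sum_erase _ _ hD₀d] at hright
  have hrest : Even (∑ D ∈ doors.erase D₀, #{R ∈ rooms | D ⊆ R}) := by
    refine even_sum _ fun D hD => ?_
    obtain ⟨hne, hD⟩ := mem_erase.1 hD
    have := (mem_filter.1 hD).2
    exact heven D this.1 this.2 hne
  have := hodd.add_even hrest
  exact (Nat.not_even_iff_odd.2 this) hright

/-- A set `S` is dominant for the rankings `r i` if every element is ranked, for some `i`, no higher
than all of `S`. -/
def IsDominant {V I : Type*} (r : I → V → ℕ) (S : Finset V) : Prop :=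
  ∀ y, ∃ i, ∀ s ∈ S, r i y ≤ r i s

theorem IsDominant.mono {V I : Type*} {r : I → V → ℕ} {S T : Finset V} (hT : IsDominant r T)
    (h : S ⊆ T) : IsDominant r S := fun y =>
  (hT y).imp fun _ hi s hs => hi s (h hs)

section Door

variable {V I : Type*} {r : I → V → ℕ} {D : Finset V} {m : I → V}

/-- The elements that can be adjoined to `D` so as to replace `m a` as `r a`-minimum. -/
def IsReplacement (r : I → V → ℕ) (m : I → V) (a : I) (y : V) : Prop :=
  (∀ j, j ≠ a → r j (m j) < r j y) ∧
    ∀ z, (∀ j, j ≠ a → r j (m j) < r j z) → r a z ≤ r a y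

theorem isReplacement_of_isDominant_insert [DecidableEq V] (hr : ∀ i, Function.Injective (r i))
    (hmD : ∀ i, m i ∈ D) (hmin : ∀ i, ∀ s ∈ D, r i (m i) ≤ r i s) {a : I}
    (hinj : ∀ i j, i ≠ a → j ≠ a → m i = m j → i = j) {y : V} (hyD : y ∉ D)
    (hya : ∀ s ∈ D, r a y ≤ r a s) (hdom : IsDominant r (insert y D)) :
    IsReplacement r m a y := by
  refine ⟨fun j hj => ?_, fun z hz => ?_⟩
  · obtain ⟨l, hl⟩ := hdom (m j)
    have hml : m l = m j := hr l <| le_antisymm (hmin l _ (hmD j))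
      (hl _ (Finset.mem_insert_of_mem (hmD l)))
    have hly := hl y (Finset.mem_insert_self _ _)
    have hla : l ≠ a := by
      rintro rfl
      exact hyD (hr l (le_antisymm (hya _ (hmD j)) hly) ▸ hmD j)
    obtain rfl := hinj l j hla hj hml
    exact lt_of_le_of_ne hly fun h => hyD (hr l h ▸ hmD l)
  · obtain ⟨l, hl⟩ := hdom z
    by_cases hla : l = a
    · exact hla ▸ hl y (Finset.mem_insert_self _ _)
    · exact absurd (hl _ (Finset.mem_insert_of_mem (hmD l))) (hz l hla).not_ge

theorem IsReplacement.isDominant_insert [DecidableEq V] (hD : IsDominant r D)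
    (hmD : ∀ i, m i ∈ D) (hmin : ∀ i, ∀ s ∈ D, r i (m i) ≤ r i s) {a : I} {y : V}
    (hy : IsReplacement r m a y) : IsDominant r (insert y D) := by
  intro w
  by_cases hw : ∀ j, j ≠ a → r j (m j) < r j w
  · obtain ⟨l, hl⟩ := hD w
    have hla : l = a := by
      by_contra hla
      exact (hw l hla).not_ge (hl _ (hmD l))
    subst hla
    exact ⟨l, by simpa using ⟨hy.2 w hw, hl⟩⟩
  · push Not at hw
    obtain ⟨j, hj, hjw⟩ := hw
    refine ⟨j, fun s hs => ?_⟩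
    rcases Finset.mem_insert.1 hs with rfl | hs
    · exact hjw.trans (hy.1 j hj).le
    · exact hjw.trans (hmin j s hs)

theorem IsReplacement.notMem (hsurj : ∀ s ∈ D, ∃ i, m i = s) {a b : I} (hab : a ≠ b)
    (hm : m a = m b) {y : V} (hy : IsReplacement r m a y) : y ∉ D := by
  intro hyD
  obtain ⟨j, rfl⟩ := hsurj y hyD
  by_cases hj : j = a
  · subst hj
    rw [hm] at hy
    exact lt_irrefl _ (hy.1 b hab.symm)
  · exact lt_irrefl _ (hy.1 j hj)

theorem exists_isReplacement [Finite V] {a : I}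
    (h : ∃ y, ∀ j, j ≠ a → r j (m j) < r j y) : ∃ y, IsReplacement r m a y := by
  obtain ⟨y, hy, hmax⟩ := Set.exists_max_image {y | ∀ j, j ≠ a → r j (m j) < r j y} (r a)
    (Set.toFinite _) h
  exact ⟨y, hy, hmax⟩

theorem IsReplacement.eq (hr : ∀ i, Function.Injective (r i)) {a : I} {y z : V}
    (hy : IsReplacement r m a y) (hz : IsReplacement r m a z) : y = z :=
  hr a (le_antisymm (hz.2 y hy.1) (hy.2 z hz.1))

theorem filter_subset_eq_image [DecidableEq V] [Fintype V] [Fintype I] (hDc : D.card + 1 = Fintype.card I)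
    (P : Finset V → Prop) [DecidablePred P] :
    ({R ∈ ({R | R.card = Fintype.card I ∧ P R} : Finset (Finset V)) | D ⊆ R}) =
      ({y | y ∉ D ∧ P (insert y D)} : Finset V).image (insert · D) := by
  ext R
  simp only [Finset.mem_filter, Finset.mem_univ, true_and, Finset.mem_image]
  constructor
  · rintro ⟨⟨hRc, hR⟩, hDR⟩
    have hsd : (R \ D).card = 1 := by
      have := Finset.card_sdiff_add_card_eq_card hDR
      omega
    obtain ⟨x, hx⟩ := Finset.card_eq_one.1 hsd
    have hxR : x ∈ R ∧ x ∉ D := Finset.mem_sdiff.1 (hx ▸ Finset.mem_singleton_self x)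
    have hR_eq : R = insert x D := by
      rw [← Finset.sdiff_union_of_subset hDR, hx]; rfl
    exact ⟨x, ⟨hxR.2, hR_eq ▸ hR⟩, hR_eq.symm⟩
  · rintro ⟨y, ⟨hy, hP⟩, rfl⟩
    exact ⟨⟨by rw [Finset.card_insert_of_notMem hy, hDc], hP⟩, Finset.subset_insert _ _⟩

theorem card_filter_subset_eq [DecidableEq V] [Fintype V] [Fintype I] (hDc : D.card + 1 = Fintype.card I)
    (P : Finset V → Prop) [DecidablePred P] :
    ({R ∈ ({R | R.card = Fintype.card I ∧ P R} : Finset (Finset V)) | D ⊆ R}).card =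
      ({y | y ∉ D ∧ P (insert y D)} : Finset V).card := by
  rw [filter_subset_eq_image hDc, Finset.card_image_of_injOn]
  intro y hy z _ hyz
  have hy' : y ∉ D := by
    exact (Finset.mem_filter.1 (Finset.mem_coe.1 hy)).2.1
  have hyz' : y ∈ insert z D := by
    rw [← show insert y D = insert z D from hyz]
    exact Finset.mem_insert_self y D
  exact (Finset.mem_insert.1 hyz').resolve_right hy'

/-- A nonempty dominant set with one element less than there are rankings is contained in exactly
two dominant sets with one more element. -/
theorem IsDominant.card_insert_eq_two [DecidableEq V] [Fintype V] [Fintype I]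
    [DecidablePred (IsDominant r)] (hr : ∀ i, Function.Injective (r i))
    (hD : IsDominant r D) (hDc : D.card + 1 = Fintype.card I)
    (hmD : ∀ i, m i ∈ D) (hmin : ∀ i, ∀ s ∈ D, r i (m i) ≤ r i s)
    (hex : ∀ a b, a ≠ b → m a = m b → ∃ y, ∀ j, j ≠ a → r j (m j) < r j y) :
    ({y | y ∉ D ∧ IsDominant r (insert y D)} : Finset V).card = 2 := by
  classical
  have hsurj : ∀ s ∈ D, ∃ i, m i = s := fun s hs => by
    obtain ⟨i, hi⟩ := hD s
    exact ⟨i, hr i (le_antisymm (hmin i s hs) (hi _ (hmD i)))⟩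
  obtain ⟨a, -, b, -, hab, hm⟩ := Finset.exists_ne_map_eq_of_card_lt_of_maps_to
    (s := (Finset.univ : Finset I)) (t := D) (f := m)
    (by rw [Finset.card_univ]; omega) (fun i _ => hmD i)
  have hinj : ∀ a b, a ≠ b → m a = m b → ∀ i j, i ≠ a → j ≠ a → m i = m j → i = j := by
    intro a b hab hm i j hi hj hij
    have himg : D ⊆ (Finset.univ.erase a).image m := by
      intro s hs
      obtain ⟨i, rfl⟩ := hsurj s hs
      by_cases hia : i = a
      · exact Finset.mem_image.2 ⟨b, by simp [hab.symm], by rw [hia, hm]⟩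
      · exact Finset.mem_image.2 ⟨i, by simp [hia], rfl⟩
    have hce : (Finset.univ.erase a).card = D.card := by
      rw [Finset.card_erase_of_mem (Finset.mem_univ a), Finset.card_univ]; omega
    have hinj : Set.InjOn m (Finset.univ.erase a : Finset I) := by
      apply Finset.card_image_iff.1
      exact le_antisymm Finset.card_image_le (hce ▸ Finset.card_le_card himg)
    exact hinj (by simpa using hi) (by simpa using hj) hij
  obtain ⟨ya, hya⟩ := exists_isReplacement (hex a b hab hm)
  obtain ⟨yb, hyb⟩ := exists_isReplacement (hex b a hab.symm hm.symm)
  have hne : ya ≠ yb := by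
    rintro rfl
    obtain ⟨l, hl⟩ := hD ya
    by_cases hla : l = a
    · exact (hyb.1 l (hla ▸ hab)).not_ge (hl _ (hmD l))
    · exact (hya.1 l hla).not_ge (hl _ (hmD l))
  rw [← Finset.card_pair hne]
  congr 1
  ext y
  simp only [Finset.mem_filter, Finset.mem_univ, true_and, Finset.mem_insert, Finset.mem_singleton]
  constructor
  · rintro ⟨hyD, hdom⟩
    obtain ⟨i, hi⟩ := hdom y
    have hi' : ∀ s ∈ D, r i y ≤ r i s := fun s hs => hi s (Finset.mem_insert_of_mem hs)
    by_cases hia : i = a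
    · subst hia
      exact Or.inl <| (isReplacement_of_isDominant_insert hr hmD hmin (hinj i b hab hm) hyD hi'
        hdom).eq hr hya
    by_cases hib : i = b
    · subst hib
      exact Or.inr <| (isReplacement_of_isDominant_insert hr hmD hmin
        (hinj i a hab.symm hm.symm) hyD hi' hdom).eq hr hyb
    exfalso
    obtain ⟨l, hl⟩ := hdom (m i)
    have hml : m l = m i := hr l <| le_antisymm (hmin l _ (hmD i))
      (hl _ (Finset.mem_insert_of_mem (hmD l)))
    have hli : l = i := by
      by_cases hla : l = a
      · exact hinj b a hab.symm hm.symm l i (hla ▸ hab) hib hml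
      · exact hinj a b hab hm l i hla hia hml
    subst hli
    exact hyD (hr l (le_antisymm (hi' _ (hmD l)) (hl y (Finset.mem_insert_self _ _))) ▸ hmD l)
  · rintro (rfl | rfl)
    · exact ⟨hya.notMem hsurj hab hm, hya.isDominant_insert hD hmD hmin⟩
    · exact ⟨hyb.notMem hsurj hab.symm hm.symm, hyb.isDominant_insert hD hmD hmin⟩

end Door

/-- **Scarf's lemma** for injective rankings with slack elements `e i`. -/
theorem exists_isDominant_image_eq_univ {V I : Type*} [Finite V] [Fintype I] [DecidableEq I]
    [Nonempty I] {r : I → V → ℕ} (hr : ∀ i, Function.Injective (r i)) (e : I → V)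
    (hmin : ∀ i v, r i (e i) ≤ r i v)
    (hmax : ∀ i j v, i ≠ j → v ∉ Set.range e → r i v < r i (e j))
    (c : V → I) (hc : ∀ i, c (e i) = i) :
    ∃ S : Finset V, IsDominant r S ∧ S.image c = Finset.univ := by
  classical
  have := Fintype.ofFinite V
  have he : Function.Injective e := Function.LeftInverse.injective hc
  obtain ⟨k⟩ := ‹Nonempty I›
  set D₀ : Finset V := (Finset.univ.erase k).image e with hD₀
  have hD₀mem : ∀ v, v ∈ D₀ ↔ ∃ j, j ≠ k ∧ e j = v := by simp [hD₀]
  have hD₀c : D₀.card + 1 = Fintype.card I := by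
    rw [hD₀, Finset.card_image_of_injective _ he, Finset.card_erase_of_mem (Finset.mem_univ k),
      Finset.card_univ]
    have := Fintype.card_pos_iff.2 ⟨k⟩
    omega
  suffices h : ∃ S ∈ ({R | R.card = Fintype.card I ∧ IsDominant r R} : Finset (Finset V)),
      S.image c = Finset.univ by
    obtain ⟨S, hS, hSc⟩ := h
    exact ⟨S, (Finset.mem_filter.1 hS).2.2, hSc⟩
  refine exists_image_eq_univ_of_odd_card_rooms
    ({R | R.card = Fintype.card I ∧ IsDominant r R} : Finset (Finset V)) c k D₀
    (fun R hR => (Finset.mem_filter.1 hR).2.1) ?_ hD₀c ?_ ?_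
  · rw [hD₀, Finset.image_image, show c ∘ e = id from funext hc, Finset.image_id]
  · rw [card_filter_subset_eq hD₀c]
    obtain ⟨y, hy, hymax⟩ := Set.exists_max_image {y | y ∉ D₀} (r k) (Set.toFinite _)
      ⟨e k, fun h => by
        obtain ⟨j, hj, hje⟩ := (hD₀mem _).1 h
        exact hj (he hje)⟩
    have : ({y | y ∉ D₀ ∧ IsDominant r (insert y D₀)} : Finset V) = {y} := by
      ext z
      simp only [Finset.mem_filter, Finset.mem_univ, true_and, Finset.mem_singleton]
      constructor
      · rintro ⟨hz, hdom⟩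
        apply hr k (le_antisymm (hymax z hz) _)
        obtain ⟨l, hl⟩ := hdom y
        by_cases hlk : l = k
        · exact hlk ▸ hl z (Finset.mem_insert_self _ _)
        · have hel : e l ∈ D₀ := (hD₀mem _).2 ⟨l, hlk, rfl⟩
          have := hr l (le_antisymm (hl _ (Finset.mem_insert_of_mem hel)) (hmin l y))
          exact absurd (this ▸ hel) hy
      · rintro rfl
        refine ⟨hy, fun w => ?_⟩
        by_cases hw : w ∈ Set.range e
        · obtain ⟨j, rfl⟩ := hw
          exact ⟨j, fun s _ => hmin j s⟩
        · refine ⟨k, fun s hs => ?_⟩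
          rcases Finset.mem_insert.1 hs with rfl | hs
          · refine hymax w fun h => hw ?_
            obtain ⟨j, -, hj⟩ := (hD₀mem _).1 h
            exact ⟨j, hj⟩
          · obtain ⟨j, hj, rfl⟩ := (hD₀mem _).1 hs
            exact (hmax k j w hj.symm hw).le
    rw [this, Finset.card_singleton]
    exact odd_one
  · intro D hDimg hDc hDD₀
    rw [card_filter_subset_eq hDc]
    by_cases hD : IsDominant r D
    swap
    · have : ({y | y ∉ D ∧ IsDominant r (insert y D)} : Finset V) = ∅ := by
        refine Finset.filter_eq_empty_iff.2 fun y _ h => hD (h.2.mono (Finset.subset_insert _ _))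
      simp [this]
    have hx : ∃ x ∈ D, x ∉ Set.range e := by
      by_contra! h
      refine hDD₀ (Finset.eq_of_subset_of_card_le (fun v hv => ?_) (by omega))
      obtain ⟨j, rfl⟩ := h v hv
      have : c (e j) ∈ D.image c := Finset.mem_image_of_mem c hv
      rw [hDimg, hc] at this
      exact (hD₀mem _).2 ⟨j, Finset.ne_of_mem_erase this, rfl⟩
    obtain ⟨x, hxD, hx⟩ := hx
    choose m hmD hm using fun i => Finset.exists_min_image D (r i) ⟨x, hxD⟩
    have hme : ∀ i j, m i = e j → i = j := by
      intro i j hij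
      by_contra hne
      exact (hmax i j x hne hx).not_ge (hij ▸ hm i x hxD)
    rw [hD.card_insert_eq_two hr hDc hmD hm]
    · exact even_two
    · intro a b hab hmab
      refine ⟨e a, fun j hja => ?_⟩
      by_cases hj : m j ∈ Set.range e
      · obtain ⟨l, hl⟩ := hj
        obtain rfl := hme j l hl.symm
        rw [← hl]
        exact lt_of_le_of_ne (hmin j _) fun h => hja (he (hr j h))
      · exact hmax j a _ hja hj

/-- **Scarf's lemma**, with ties allowed in the rankings. -/
theorem exists_dominant_image_eq_univ {V I : Type*} [Finite V] [Fintype I] [DecidableEq I]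
    [Nonempty I] {f : I → V → ℕ} (e : I → V)
    (hmin : ∀ i v, v ≠ e i → f i (e i) < f i v)
    (hmax : ∀ i j v, i ≠ j → v ∉ Set.range e → f i v < f i (e j))
    (c : V → I) (hc : ∀ i, c (e i) = i) :
    ∃ S : Finset V, IsDominant f S ∧ S.image c = Finset.univ := by
  obtain ⟨n, ⟨q⟩⟩ := Finite.exists_equiv_fin V
  set r : I → V → ℕ := fun i v => f i v * n + q v with hr
  have hlt : ∀ i v w, f i v < f i w → r i v < r i w := by
    intro i v w h
    have h1 : (f i v + 1) * n ≤ f i w * n := Nat.mul_le_mul_right n h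
    have h2 := (q v).isLt
    simp only [hr]
    nlinarith
  suffices h : ∃ S : Finset V, IsDominant r S ∧ S.image c = Finset.univ by
    obtain ⟨S, hS, hSc⟩ := h
    refine ⟨S, fun y => (hS y).imp fun i hi s hs => ?_, hSc⟩
    by_contra! h
    exact (hlt i s y h).not_ge (hi s hs)
  refine exists_isDominant_image_eq_univ (r := r) (fun i v w h => ?_) e
    (fun i v => ?_) (fun i j v hij hv => hlt _ _ _ (hmax i j v hij hv)) c hc
  · have hf : f i v = f i w := by
      rcases lt_trichotomy (f i v) (f i w) with h' | h' | h'
      · exact absurd h (hlt _ _ _ h').ne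
      · exact h'
      · exact absurd h (hlt _ _ _ h').ne'
    apply q.injective
    apply Fin.ext
    simp only [hr, hf] at h
    omega
  · by_cases hv : v = e i
    · rw [hv]
    · exact (hlt _ _ _ (hmin i v hv)).le

/-- A function on `C` with sum at most `N` is dominated by one supported on `C` with sum `N`. -/
theorem exists_le_sum_eq {ι : Type*} [Fintype ι] {C : Finset ι} (hC : C.Nonempty)
    (w : ι → ℕ) {N : ℕ} (hw : ∑ i ∈ C, w i ≤ N) :
    ∃ z : ι → ℕ, (∀ i ∈ C, w i ≤ z i) ∧ (∀ i ∉ C, z i = 0) ∧ ∑ i, z i = N := by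
  classical
  obtain ⟨k, hk⟩ := hC
  refine ⟨fun i => (if i ∈ C then w i else 0) + if i = k then N - ∑ i ∈ C, w i else 0,
    fun i hi => by simp [hi], fun i hi => ?_, ?_⟩
  · have : i ≠ k := fun h => hi (h ▸ hk)
    simp [hi, this]
  · rw [Finset.sum_add_distrib]
    simp
    omega

/-- A set of integer points of the dilated simplex that is rainbow for a given colouring, is close
to a point `z`, and has only colours in the support of `z`. -/
theorem exists_grid_rainbow {ι : Type*} [Fintype ι] [Nonempty ι] (N : ℕ)
    (c : (ι → ℕ) → ι) :
    ∃ z : ι → ℕ, ∑ i, z i = N ∧ ∀ i, z i ≠ 0 → ∃ x : ι → ℕ, ∑ j, x j = N ∧ c x = i ∧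
      ∀ j, x j ≤ z j + Fintype.card ι ∧ z j ≤ x j + Fintype.card ι := by
  classical
  set T := {x : ι → ℕ // x ∈ Finset.piAntidiag Finset.univ N}
  have hT : ∀ x : ι → ℕ, x ∈ Finset.piAntidiag Finset.univ N ↔ ∑ i, x i = N := fun x => by simp
  obtain ⟨S, hS, hSc⟩ := exists_dominant_image_eq_univ (V := T ⊕ ι)
    (f := fun i => Sum.elim (fun x => x.1 i + 1) (fun j => if j = i then 0 else N + 2))
    Sum.inr
    (by rintro i (x | j) h
        · simp
        · have : j ≠ i := fun h' => h (h' ▸ rfl)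
          simp [this])
    (by rintro i j (x | l) hij hl
        · have : x.1 i ≤ N := by
            exact (Finset.single_le_sum (f := x.1) (fun _ _ => Nat.zero_le _)
              (Finset.mem_univ i)).trans_eq ((hT x.1).1 x.2)
          simp [hij.symm]; omega
        · exact absurd ⟨l, rfl⟩ hl)
    (Sum.elim (fun x => c x.1) id) (fun i => rfl)
  set C : Finset ι := {i | Sum.inr i ∉ S} with hC
  have hcol : ∀ i ∈ C, ∃ x : T, Sum.inl x ∈ S ∧ c x.1 = i := by
    intro i hi
    have : i ∈ S.image _ := hSc ▸ Finset.mem_univ i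
    obtain ⟨v | j, hv, hvi⟩ := Finset.mem_image.1 this
    · exact ⟨v, hv, hvi⟩
    · have hij : j = i := hvi
      exact absurd (hij ▸ hv) (Finset.mem_filter.1 hi).2
  -- every grid point is dominated in a direction of `C`
  have hdom : ∀ y : ι → ℕ, ∑ i, y i = N → ∃ i ∈ C, ∀ x : T, Sum.inl x ∈ S → y i ≤ x.1 i := by
    intro y hy
    obtain ⟨i, hi⟩ := hS (Sum.inl ⟨y, (hT y).2 hy⟩)
    refine ⟨i, ?_, fun x hx => by simpa using hi _ hx⟩
    refine Finset.mem_filter.2 ⟨Finset.mem_univ _, fun h => ?_⟩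
    simpa using hi _ h
  have hCne : C.Nonempty := by
    obtain ⟨i⟩ := ‹Nonempty ι›
    obtain ⟨j, hj, -⟩ := hdom (fun j => if j = i then N else 0) (by simp)
    exact ⟨j, hj⟩
  have hσ : ({x | Sum.inl x ∈ S} : Finset T).Nonempty := by
    obtain ⟨i, hi⟩ := hCne
    obtain ⟨x, hx, -⟩ := hcol i hi
    exact ⟨x, by simpa using hx⟩
  choose p hp hpmin using fun i : ι => Finset.exists_min_image _ (fun x : T => x.1 i) hσ
  set m : ι → ℕ := fun i => (p i).1 i with hm
  have hmx : ∀ x : T, Sum.inl x ∈ S → ∀ i, m i ≤ x.1 i := fun x hx i =>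
    hpmin i x (by simpa using hx)
  have hsum : N < ∑ i ∈ C, (m i + 1) := by
    by_contra! h
    obtain ⟨y, hy, -, hyN⟩ := exists_le_sum_eq hCne _ h
    obtain ⟨i, hi, hle⟩ := hdom y hyN
    have h1 := hle (p i) (by simpa using hp i)
    have h2 := hy i hi
    simp only [hm] at h2
    omega
  have hmN : ∀ x : T, Sum.inl x ∈ S → ∑ i ∈ C, m i ≤ N := fun x hx =>
    calc ∑ i ∈ C, m i ≤ ∑ i ∈ C, x.1 i := Finset.sum_le_sum fun i _ => hmx x hx i
      _ ≤ ∑ i, x.1 i := Finset.sum_le_sum_of_subset (Finset.subset_univ _)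
      _ = N := (hT x.1).1 x.2
  have hclose : ∀ w : ι → ℕ, (∀ i ∈ C, m i ≤ w i) → ∑ i, w i = N →
      ∀ j, w j ≤ (if j ∈ C then m j else 0) + Fintype.card ι := by
    intro w hw hwN j
    have h1 : ∑ i, (if i ∈ C then m i else 0) = ∑ i ∈ C, m i := by simp
    have h2 : ∑ i, (w i - if i ∈ C then m i else 0) + ∑ i ∈ C, m i = N := by
      rw [← h1, ← Finset.sum_add_distrib, ← hwN]
      refine Finset.sum_congr rfl fun i _ => Nat.sub_add_cancel ?_
      split_ifs with h
      · exact hw i h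
      · exact Nat.zero_le _
    have h3 : w j - (if j ∈ C then m j else 0) ≤ ∑ i, (w i - if i ∈ C then m i else 0) :=
      Finset.single_le_sum (f := fun i => w i - if i ∈ C then m i else 0)
        (fun _ _ => Nat.zero_le _) (Finset.mem_univ j)
    rw [Finset.sum_add_distrib] at hsum
    have h4 : ∑ i ∈ C, 1 ≤ Fintype.card ι := by
      simpa using Finset.card_le_univ C
    omega
  obtain ⟨x₀, hx₀⟩ := hσ
  obtain ⟨z, hz, hz0, hzN⟩ := exists_le_sum_eq hCne m (hmN x₀ (by simpa using hx₀))
  refine ⟨z, hzN, fun i hi => ?_⟩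
  have hiC : i ∈ C := by
    by_contra h
    exact hi (hz0 i h)
  obtain ⟨x, hx, hxi⟩ := hcol i hiC
  have hxN := (hT x.1).1 x.2
  refine ⟨x.1, hxN, hxi, fun j => ?_⟩
  have h1 := hclose x.1 (fun i _ => hmx x hx i) hxN j
  have h2 := hclose z hz hzN j
  by_cases hj : j ∈ C
  · have h3 := hmx x hx j
    have h4 := hz j hj
    simp only [hj, if_true] at h1 h2
    omega
  · have h3 := hz0 j hj
    simp only [hj, if_false] at h1 h2
    omega

/-- The Knaster-Kuratowski-Mazurkiewicz lemma for open covers of a simplex. -/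
theorem exists_mem_stdSimplex_forall_mem_of_cover {ι : Type*} [Fintype ι] [Nonempty ι]
    {U : ι → Set (ι → ℝ)} (hU : ∀ i, IsOpen (U i)) (hcov : stdSimplex ℝ ι ⊆ ⋃ i, U i) :
    ∃ x ∈ stdSimplex ℝ ι, ∀ i, x i ≠ 0 → x ∈ U i := by
  obtain ⟨δ, hδ, hball⟩ := lebesgue_number_lemma_of_metric (isCompact_stdSimplex ℝ ι) hU hcov
  obtain ⟨N, hN⟩ := exists_nat_gt ((Fintype.card ι : ℝ) / δ)
  have hN0 : (0 : ℝ) < N := lt_of_le_of_lt (by positivity) hN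
  set g : (ι → ℕ) → ι → ℝ := fun x i => (x i : ℝ) / N with hg
  have hgmem : ∀ x : ι → ℕ, ∑ i, x i = N → g x ∈ stdSimplex ℝ ι := by
    intro x hx
    refine ⟨fun i => by positivity, ?_⟩
    simp only [hg]
    rw [← Finset.sum_div, ← Nat.cast_sum, hx, div_self hN0.ne']
  have hc : ∀ x : ι → ℕ, ∃ i, ∑ j, x j = N → Metric.ball (g x) δ ⊆ U i := by
    intro x
    by_cases hx : ∑ j, x j = N
    · exact (hball _ (hgmem x hx)).imp fun i hi _ => hi
    · exact ⟨Classical.arbitrary ι, fun h => absurd h hx⟩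
  choose c hc using hc
  obtain ⟨z, hzN, hz⟩ := exists_grid_rainbow N c
  refine ⟨g z, hgmem z hzN, fun i hi => ?_⟩
  obtain ⟨x, hxN, rfl, hxz⟩ := hz i fun h => hi (by simp [hg, h])
  refine hc x hxN ?_
  rw [Metric.mem_ball, dist_pi_lt_iff hδ]
  intro j
  have hlt : (Fintype.card ι : ℝ) / N < δ := by
    rw [div_lt_iff₀ hδ] at hN
    rw [div_lt_iff₀ hN0]
    linarith
  refine lt_of_le_of_lt ?_ hlt
  have h1 : (x j : ℝ) ≤ z j + Fintype.card ι := by exact_mod_cast (hxz j).1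
  have h2 : (z j : ℝ) ≤ x j + Fintype.card ι := by exact_mod_cast (hxz j).2
  rw [Real.dist_eq, ← sub_div, abs_div, abs_of_pos hN0]
  gcongr
  rw [abs_le]
  constructor <;> linarith

open Topology in
/-- The **Fan-Browder fixed point theorem**: a correspondence with convex values on a compact convex
set that admits locally constant selections has a fixed point. -/
theorem IsCompact.exists_mem_of_eventually_mem {E : Type*} [AddCommGroup E] [Module ℝ E]
    [TopologicalSpace E] [ContinuousAdd E] [ContinuousSMul ℝ E] {K : Set E}
    (hK : IsCompact K) (hKc : Convex ℝ K) (hKne : K.Nonempty) {Φ : E → Set E}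
    (hΦc : ∀ u ∈ K, Convex ℝ (Φ u)) (hΦ : ∀ u ∈ K, ∃ v ∈ K, ∀ᶠ w in 𝓝[K] u, v ∈ Φ w) :
    ∃ u ∈ K, u ∈ Φ u := by
  choose! v hvK hv using hΦ
  choose! O hO using fun u (hu : u ∈ K) => mem_nhdsWithin.1 (hv u hu)
  obtain ⟨t, htK, ht⟩ := hK.elim_nhds_subcover O fun u hu => (hO u hu).1.mem_nhds (hO u hu).2.1
  have : Nonempty t := by
    obtain ⟨u, hu⟩ := hKne
    obtain ⟨s, hs, -⟩ := Set.mem_iUnion₂.1 (ht hu)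
    exact ⟨⟨s, hs⟩⟩
  set g : (t → ℝ) → E := fun x => ∑ i, x i • v i with hg
  have hgc : Continuous g := by fun_prop
  have hgK : ∀ x ∈ stdSimplex ℝ t, g x ∈ K := fun x hx =>
    hKc.sum_mem (fun i _ => hx.1 i) hx.2 fun i _ => hvK _ (htK i i.2)
  obtain ⟨x, hx, hxU⟩ := exists_mem_stdSimplex_forall_mem_of_cover (ι := t)
    (U := fun i => g ⁻¹' O i) (fun i => (hO i (htK i i.2)).1.preimage hgc) fun x hx => by
      obtain ⟨s, hs, hxs⟩ := Set.mem_iUnion₂.1 (ht (hgK x hx))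
      exact Set.mem_iUnion.2 ⟨⟨s, hs⟩, hxs⟩
  refine ⟨g x, hgK x hx, ?_⟩
  have hsum : g x = ∑ i with x i ≠ 0, x i • v i := by
    rw [Finset.sum_filter_of_ne]
    intro i _ h h0
    exact h (by rw [h0, zero_smul])
  nth_rewrite 2 [hsum]
  refine (hΦc _ (hgK x hx)).sum_mem (fun i _ => hx.1 i) ?_ fun i hi => ?_
  · rw [Finset.sum_filter_ne_zero]
    exact hx.2
  · exact (hO i (htK i i.2)).2.2 ⟨hxU i (Finset.mem_filter.1 hi).2, hgK x hx⟩

theorem ContinuousOn.continuous_update {ι : Type*} [DecidableEq ι] {E : ι → Type*}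
    [∀ i, TopologicalSpace (E i)] {C : ∀ i, Set (E i)} {X Y : Type*} [TopologicalSpace X] [TopologicalSpace Y]
    {f : X × (∀ i, E i) → ℝ} (hf : ContinuousOn f (Set.univ ×ˢ Set.univ.pi C)) (i : ι)
    {p : Y → X} {u : Y → ∀ j, E j} {v : Y → E i} (hp : Continuous p) (hu : Continuous u)
    (hv : Continuous v) (huC : ∀ y j, u y j ∈ C j) (hvC : ∀ y, v y ∈ C i) :
    Continuous fun y => f (p y, Function.update (u y) i (v y)) := by
  refine hf.comp_continuous (hp.prodMk (hu.update i hv)) fun y => ⟨Set.mem_univ _, fun j _ => ?_⟩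
  by_cases h : j = i
  · subst h
    simpa using hvC y
  · simpa [h] using huC y j

section Nash

variable {ι : Type*} [Fintype ι] [DecidableEq ι] {E : ι → Type*} [∀ i, NormedAddCommGroup (E i)]
  [∀ i, NormedSpace ℝ (E i)] {C : ∀ i, Set (E i)}

open Topology in
/-- Existence of approximate Nash equilibria for continuous quasiconcave games on compact convex
sets. -/
theorem exists_approx_nash
    (hCne : ∀ i, (C i).Nonempty) (hCcp : ∀ i, IsCompact (C i)) (hCcv : ∀ i, Convex ℝ (C i))
    {J : ι → (∀ i, E i) → ℝ} (hJ : ∀ i, ContinuousOn (J i) (Set.univ.pi C))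
    (hqc : ∀ i, ∀ u ∈ Set.univ.pi C,
      QuasiconcaveOn ℝ (C i) (fun v => J i (Function.update u i v)))
    {ε : ℝ} (hε : 0 < ε) :
    ∃ u ∈ Set.univ.pi C, ∀ i, ∀ v ∈ C i, J i (Function.update u i v) < J i u + ε := by
  have hf : ∀ i, ContinuousOn (fun q : Unit × (∀ i, E i) => J i q.2)
      (Set.univ ×ˢ Set.univ.pi C) := fun i =>
    (hJ i).comp continuousOn_snd fun q hq => hq.2
  suffices h : ∃ u ∈ Set.univ.pi C, u ∈ {v : ∀ i, E i | ∀ i, v i ∈ C i ∧ ∀ w ∈ C i,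
      J i (Function.update u i w) < J i (Function.update u i (v i)) + ε} by
    obtain ⟨u, hu, hΦ⟩ := h
    exact ⟨u, hu, fun i v hv => by simpa using (hΦ i).2 v hv⟩
  refine (isCompact_univ_pi hCcp).exists_mem_of_eventually_mem
    (convex_pi fun i _ => hCcv i) (Set.univ_pi_nonempty_iff.2 hCne)
    (Φ := fun u => {v | ∀ i, v i ∈ C i ∧ ∀ w ∈ C i,
      J i (Function.update u i w) < J i (Function.update u i (v i)) + ε})
    (fun u hu => ?_) (fun u hu => ?_)
  · intro v hv v' hv' a b ha hb hab i
    refine ⟨hCcv i (hv i).1 (hv' i).1 ha hb hab, fun w hw => ?_⟩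
    have := ((hqc i u hu).convex_gt (J i (Function.update u i w) - ε))
      (x := v i) ⟨(hv i).1, by linarith [(hv i).2 w hw]⟩
      (y := v' i) ⟨(hv' i).1, by linarith [(hv' i).2 w hw]⟩ ha hb hab
    have := this.2
    simp only [Pi.add_apply, Pi.smul_apply]
    linarith
  · have hmax : ∀ i, ∃ v ∈ C i, ∀ w ∈ C i,
        J i (Function.update u i w) ≤ J i (Function.update u i v) := by
      intro i
      obtain ⟨v, hv, hmax⟩ := (hCcp i).exists_isMaxOn (hCne i)
        (f := fun v => J i (Function.update u i v)) <| continuousOn_iff_continuous_domRestrict.2 <|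
        (hf i).continuous_update i (Y := C i) (u := fun _ => u) (v := fun y => y)
          (continuous_const (y := ())) continuous_const continuous_subtype_val
          (fun _ j => hu j (Set.mem_univ j)) fun y => y.2
      exact ⟨v, hv, fun w hw => hmax hw⟩
    choose v hvC hv using hmax
    refine ⟨v, fun i _ => hvC i, ?_⟩
    rw [← eventually_nhds_subtype_iff (Set.univ.pi C) ⟨u, hu⟩]
    simp only [Set.mem_ofPred_eq]
    rw [Filter.eventually_all]
    intro i
    have : CompactSpace (C i) := isCompact_iff_compactSpace.1 (hCcp i)
    have key : ∀ᶠ x : Set.univ.pi C in 𝓝 ⟨u, hu⟩, ∀ w ∈ (Set.univ : Set (C i)),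
        J i (Function.update (x : ∀ i, E i) i (w : E i)) <
          J i (Function.update (x : ∀ i, E i) i (v i)) + ε := by
      refine isCompact_univ.eventually_forall_of_forall_eventually fun w _ => ?_
      have h1 := (hf i).continuous_update i (Y := Set.univ.pi C × C i) (u := fun q => q.1)
        (v := fun q => q.2) (continuous_const (y := ())) (by fun_prop) (by fun_prop)
        (fun q j => q.1.2 j (Set.mem_univ j)) fun q => q.2.2
      have h2 := (hf i).continuous_update i (Y := Set.univ.pi C × C i) (u := fun q => q.1)
        (v := fun _ => v i) (continuous_const (y := ())) (by fun_prop) (by fun_prop)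
        (fun q j => q.1.2 j (Set.mem_univ j)) fun q => hvC i
      refine (isOpen_lt h1 (h2.add continuous_const)).mem_nhds ?_
      have := hv i w w.2
      exact lt_of_le_of_lt this (lt_add_of_pos_right _ hε)
    filter_upwards [key] with x hx
    exact ⟨hvC i, fun w hw => hx ⟨w, hw⟩ (Set.mem_univ _)⟩

open Topology in
/-- Existence of Nash equilibria for continuous quasiconcave games on compact convex sets. -/
theorem exists_nash
    (hCne : ∀ i, (C i).Nonempty) (hCcp : ∀ i, IsCompact (C i)) (hCcv : ∀ i, Convex ℝ (C i))
    {J : ι → (∀ i, E i) → ℝ} (hJ : ∀ i, ContinuousOn (J i) (Set.univ.pi C))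
    (hqc : ∀ i, ∀ u ∈ Set.univ.pi C,
      QuasiconcaveOn ℝ (C i) (fun v => J i (Function.update u i v))) :
    ∃ u ∈ Set.univ.pi C, ∀ i, ∀ v ∈ C i, J i (Function.update u i v) ≤ J i u := by
  have hf : ∀ i, ContinuousOn (fun q : Unit × (∀ i, E i) => J i q.2)
      (Set.univ ×ˢ Set.univ.pi C) := fun i =>
    (hJ i).comp continuousOn_snd fun q hq => hq.2
  choose u hu hlt using fun k : ℕ => exists_approx_nash hCne hCcp hCcv hJ hqc
    (Nat.one_div_pos_of_nat (α := ℝ) (n := k))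
  have : CompactSpace (Set.univ.pi C) := isCompact_iff_compactSpace.1 (isCompact_univ_pi hCcp)
  obtain ⟨x, φ, hφ, hx⟩ := CompactSpace.tendsto_subseq
    (fun k => (⟨u k, hu k⟩ : Set.univ.pi C))
  refine ⟨x, x.2, fun i v hv => ?_⟩
  have h1 := (hf i).continuous_update i (Y := Set.univ.pi C) (u := fun q => q)
    (v := fun _ => v) (continuous_const (y := ())) (by fun_prop) (by fun_prop)
    (fun q j => q.2 j (Set.mem_univ j)) fun q => hv
  have h2 : Continuous fun q : Set.univ.pi C => J i q := (hJ i).domRestrict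
  have h3 := (h2.tendsto x).comp hx
  have h4 := (tendsto_one_div_add_atTop_nhds_zero_nat (𝕜 := ℝ)).comp hφ.tendsto_atTop
  have h5 := h3.add h4
  rw [add_zero] at h5
  exact le_of_tendsto_of_tendsto' ((h1.tendsto x).comp hx) h5
    fun k => (hlt (φ k) i v hv).le

end Nash

/-- If each follower's strategy set `C i` is a nonempty compact
convex subset of a finite-dimensional real vector space and each
`v ↦ J_i u₀ (v, u_{-i})` is quasiconcave on `C i`, then the game with one
leader and `n` followers playing Nash equilibrium admits an inverse Stackelberg
solution. -/
theorem exists_inverse_stackelberg_many_followers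
    {n : ℕ} {P₀ : Type*} {E : Fin n → Type*}
    [TopologicalSpace P₀] [CompactSpace P₀] [Nonempty P₀]
    [∀ i, NormedAddCommGroup (E i)] [∀ i, NormedSpace ℝ (E i)]
    [∀ i, FiniteDimensional ℝ (E i)]
    (C : ∀ i, Set (E i))
    (hCne : ∀ i, (C i).Nonempty) (hCcp : ∀ i, IsCompact (C i))
    (hCcv : ∀ i, Convex ℝ (C i))
    (J₀ : P₀ → (∀ i, E i) → ℝ) (J : Fin n → P₀ → (∀ i, E i) → ℝ)
    -- continuity of the payoffs on `P₀ × P`: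
    (hJ₀ : ContinuousOn (fun p : P₀ × (∀ i, E i) => J₀ p.1 p.2)
      (Set.univ ×ˢ Set.univ.pi C))
    (hJ : ∀ i, ContinuousOn (fun p : P₀ × (∀ i, E i) => J i p.1 p.2)
      (Set.univ ×ˢ Set.univ.pi C))
    -- quasiconcavity of `v ↦ J_i u₀ (v, u_{-i})` on `C i`:
    (hqc : ∀ (u₀ : P₀) (i : Fin n) (u : ∀ j, E j), (∀ j, u j ∈ C j) →
      QuasiconcaveOn ℝ (C i) (fun v => J i u₀ (Function.update u i v))) :
    ∃ (αs : (∀ i, E i) → P₀) (us : ∀ i, E i),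
      (∀ i, us i ∈ C i) ∧
      -- `u* ∈ E(α*)`:
      (∀ i, ∀ v ∈ C i,
        J i (αs (Function.update us i v)) (Function.update us i v) ≤ J i (αs us) us) ∧
      -- optimality of `(α*, u*)`:
      ∀ (α : (∀ i, E i) → P₀) (u : ∀ i, E i), (∀ i, u i ∈ C i) →
        (∀ i, ∀ v ∈ C i,
          J i (α (Function.update u i v)) (Function.update u i v) ≤ J i (α u) u) →
        J₀ (α u) u ≤ J₀ (αs us) us := by
  classical
  set K : Set (∀ i, E i) := Set.univ.pi C with hK
  have : CompactSpace K := isCompact_iff_compactSpace.1 (isCompact_univ_pi hCcp)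
  -- the pairs `(u₀, u)` at which every deviation `v` can be punished by some `w`
  set D : Set (P₀ × K) := {q | ∀ i, ∀ v ∈ C i, ∃ w : P₀,
    J i w (Function.update (q.2 : ∀ i, E i) i v) ≤ J i q.1 q.2} with hD
  have hcontJ : ∀ i, Continuous fun q : P₀ × K => J i q.1 q.2 := fun i =>
    (hJ i).comp_continuous (f := fun q : P₀ × K => (q.1, (q.2 : ∀ i, E i))) (by fun_prop)
      fun q => ⟨Set.mem_univ _, q.2.2⟩
  have hcontJ₀ : Continuous fun q : P₀ × K => J₀ q.1 q.2 :=
    hJ₀.comp_continuous (f := fun q : P₀ × K => (q.1, (q.2 : ∀ i, E i))) (by fun_prop)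
      fun q => ⟨Set.mem_univ _, q.2.2⟩
  have hDclosed : IsClosed D := by
    simp only [hD, Set.ofPred_forall]
    refine isClosed_iInter fun i => isClosed_iInter fun v => isClosed_iInter fun hv => ?_
    have hcl : IsClosed {q : (P₀ × K) × P₀ |
        J i q.2 (Function.update (q.1.2 : ∀ i, E i) i v) ≤ J i q.1.1 q.1.2} :=
      isClosed_le ((hJ i).continuous_update i (p := fun q : (P₀ × K) × P₀ => q.2)
        (u := fun q => q.1.2) (v := fun _ => v) (by fun_prop) (by fun_prop) (by fun_prop)
        (fun q j => q.1.2.2 j (Set.mem_univ j)) fun _ => hv) ((hcontJ i).comp continuous_fst)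
    convert isClosedMap_fst_of_compactSpace _ hcl using 1
    ext q
    constructor
    · rintro ⟨w, hw⟩
      exact ⟨(q, w), hw, rfl⟩
    · rintro ⟨⟨q', w⟩, hw, rfl⟩
      exact ⟨w, hw⟩
  have hDne : D.Nonempty := by
    obtain ⟨u₀⟩ := ‹Nonempty P₀›
    obtain ⟨u, hu, hmax⟩ := exists_nash hCne hCcp hCcv (J := fun i => J i u₀)
      (fun i => (hJ i).comp (f := fun u : ∀ i, E i => (u₀, u)) (by fun_prop)
        fun u hu => ⟨Set.mem_univ _, hu⟩)
      fun i u hu => hqc u₀ i u fun j => hu j (Set.mem_univ j)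
    exact ⟨(u₀, ⟨u, hu⟩), fun i v hv => ⟨u₀, hmax i v hv⟩⟩
  obtain ⟨⟨u₀, us⟩, hus, hopt⟩ := hDclosed.isCompact.exists_isMaxOn hDne hcontJ₀.continuousOn
  choose! w hw using hus
  -- punish the deviator if there is one
  set αs : (∀ i, E i) → P₀ := fun u =>
    if h : ∃ i v, u = Function.update (us : ∀ i, E i) i v ∧ u ≠ us then
      w h.choose h.choose_spec.choose else u₀ with hαs
  have hαus : αs us = u₀ := by simp [hαs]
  refine ⟨αs, us, fun i => us.2 i (Set.mem_univ i), fun i v hv => ?_, fun α u hu hα => ?_⟩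
  · rw [hαus]
    by_cases hvi : v = (us : ∀ i, E i) i
    · rw [hvi, Function.update_eq_self, hαus]
    have hne : Function.update (us : ∀ i, E i) i v ≠ us := fun h =>
      hvi (by simpa using congrFun h i)
    have h : ∃ j v', Function.update (us : ∀ i, E i) i v = Function.update (us : ∀ i, E i) j v' ∧
      Function.update (us : ∀ i, E i) i v ≠ us := ⟨i, v, rfl, hne⟩
    have hval : αs (Function.update us i v) = w h.choose h.choose_spec.choose := dif_pos h
    have hspec := h.choose_spec.choose_spec.1
    rw [hval]
    generalize h.choose_spec.choose = v' at hspec ⊢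
    generalize h.choose = j at v' hspec ⊢
    have hji : j = i := by
      by_contra hji
      have := congrFun hspec i
      rw [Function.update_self, Function.update_of_ne (Ne.symm hji)] at this
      exact hvi this
    subst hji
    have hv' : v = v' := by simpa using congrFun hspec j
    subst hv'
    exact hw j v hv
  · have hmem : ((α u, ⟨u, fun i _ => hu i⟩) : P₀ × K) ∈ D := fun i v hv => ⟨_, hα i v hv⟩
    have := hopt hmem
    rw [hαus]
    exact this
end
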